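/- Let 𝒜 be a d-algebra with a multiplicative unit e. If e is a finite element of 𝒜, then every element of 𝒜 is finite and totally finite, i.e. Φ₁(𝒜) = Φ₂(𝒜) = 𝒜. -/

import Mathlib

namespace FiniteElementsPaper

/-- Product of `p` factors `φ 0 * φ 1 * ⋯ * φ (p-1)` in a (possibly non-unital)
multiplicative structure; junk value `0` when `p = 0`. -/
def mulProd {A : Type*} [Mul A] [Zero A] : (p : ℕ) → (Fin p → A) → A
  | 0, _ => 0
  | q + 1, φ => Fin.foldl q (fun acc i => acc * φ i.succ) (φ 0)

/-- `p`-th power `a^p` (junk value `0` for `p = 0`). -/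
def mpow {A : Type*} [Mul A] [Zero A] (a : A) (p : ℕ) : A :=
  mulProd p (fun _ => a)

/-- The set `Π_p(𝒜)` of all `p`-fold products. -/
def piSet (A : Type*) [Mul A] [Zero A] (p : ℕ) : Set A :=
  {x | ∃ φ : Fin p → A, x = mulProd p φ}

variable {A : Type*} [Lattice A] [AddCommGroup A] [Module ℝ A]

/-- `z` is a majorant of `φ`: `z ≥ 0` and for every `x` there is `c > 0` with
`|x| ⊓ n • |φ| ≤ c • z` for all `n`. -/
def IsMajorant (z φ : A) : Prop :=
  0 ≤ z ∧ ∀ x : A, ∃ c : ℝ, 0 < c ∧ ∀ n : ℕ, |x| ⊓ n • |φ| ≤ c • z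

/-- `φ` is a finite element. -/
def IsFiniteElt (φ : A) : Prop := ∃ z : A, IsMajorant z φ

/-- `φ` is a totally finite element: it has a majorant which is itself finite. -/
def IsTotallyFiniteElt (φ : A) : Prop := ∃ z : A, IsMajorant z φ ∧ IsFiniteElt z

/-- `φ` is self-majorizing: `|φ|` is a majorant of `φ`. -/
def IsSelfMajorizing (φ : A) : Prop := IsMajorant |φ| φ

/-- `φ ∈ Φ₃(A) = S₊(A) - S₊(A)`. -/
def InPhi3 (φ : A) : Prop :=
  ∃ s t : A, 0 ≤ s ∧ 0 ≤ t ∧ IsSelfMajorizing s ∧ IsSelfMajorizing t ∧ φ = s - t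

/-- `w` is a majorant of `φ` relative to the subset `S` (all lattice operations
computed in the ambient algebra). -/
def IsMajorantIn (S : Set A) (w φ : A) : Prop :=
  0 ≤ w ∧ ∀ x ∈ S, ∃ c : ℝ, 0 < c ∧ ∀ n : ℕ, |x| ⊓ n • |φ| ≤ c • w

/-- `φ` is a finite element of the sublattice `S` (majorant required to lie in `S`). -/
def IsFiniteEltIn (S : Set A) (φ : A) : Prop := ∃ w ∈ S, IsMajorantIn S w φ

/-- `φ` is a totally finite element of the sublattice `S`. -/
def IsTotallyFiniteEltIn (S : Set A) (φ : A) : Prop :=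
  ∃ w ∈ S, IsMajorantIn S w φ ∧ IsFiniteEltIn S w

/-- `φ` is self-majorizing in the sublattice `S`. -/
def IsSelfMajorizingIn (S : Set A) (φ : A) : Prop := IsMajorantIn S |φ| φ

/-- `φ ∈ Φ₃(S) = S₊(S) - S₊(S)` for the sublattice `S`. -/
def InPhi3In (S : Set A) (φ : A) : Prop :=
  ∃ s t : A, s ∈ S ∧ t ∈ S ∧ 0 ≤ s ∧ 0 ≤ t ∧
    IsSelfMajorizingIn S s ∧ IsSelfMajorizingIn S t ∧ φ = s - t

variable (A) in
/-- Archimedean ℓ-algebra structure: an Archimedean vector lattice together with an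
associative bilinear multiplication whose product of positive elements is positive. -/
structure IsLAlgebra [Mul A] : Prop where
  add_le_add_left : ∀ a b : A, a ≤ b → ∀ c : A, c + a ≤ c + b
  smul_le_smul : ∀ (r : ℝ) (a b : A), 0 ≤ r → a ≤ b → r • a ≤ r • b
  archimedean : ∀ a b : A, 0 ≤ a → (∀ n : ℕ, n • a ≤ b) → a = 0
  mul_assoc : ∀ a b c : A, a * b * c = a * (b * c)
  left_distrib : ∀ a b c : A, a * (b + c) = a * b + a * c
  right_distrib : ∀ a b c : A, (a + b) * c = a * c + b * c
  smul_mul : ∀ (r : ℝ) (a b : A), (r • a) * b = r • (a * b)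
  mul_smul : ∀ (r : ℝ) (a b : A), a * (r • b) = r • (a * b)
  mul_nonneg : ∀ a b : A, 0 ≤ a → 0 ≤ b → 0 ≤ a * b

variable (A) in
/-- A `d`-algebra: ℓ-algebra in which `a ⊓ b = 0` implies `(a*c) ⊓ (b*c) = (c*a) ⊓ (c*b) = 0`
for all `c ≥ 0`. -/
structure IsDAlgebra [Mul A] extends IsLAlgebra A : Prop where
  d_prop : ∀ a b c : A, a ⊓ b = 0 → 0 ≤ c → (a * c) ⊓ (b * c) = 0 ∧ (c * a) ⊓ (c * b) = 0

variable (A) in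
/-- An `f`-algebra: ℓ-algebra in which `a ⊓ b = 0` implies `(a*c) ⊓ b = (c*a) ⊓ b = 0`
for all `c ≥ 0`. -/
structure IsFAlgebra [Mul A] extends IsLAlgebra A : Prop where
  f_prop : ∀ a b c : A, a ⊓ b = 0 → 0 ≤ c → (a * c) ⊓ b = 0 ∧ (c * a) ⊓ b = 0

/-- `e` is a multiplicative unit. -/
def IsMulUnit [Mul A] (e : A) : Prop := ∀ a : A, a * e = a ∧ e * a = a

/-- `e` is an order unit. -/
def IsOrderUnit (e : A) : Prop := 0 ≤ e ∧ ∀ x : A, ∃ l : ℝ, 0 ≤ l ∧ |x| ≤ l • e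

variable (A) in
/-- The algebra is semiprime: `0` is its only nilpotent element. -/
def IsSemiprime [Mul A] [Zero A] : Prop :=
  ∀ (a : A) (n : ℕ), 0 < n → mpow a n = 0 → a = 0

variable (A) in
/-- The vector lattice is uniformly complete. -/
def UniformlyComplete : Prop :=
  ∀ u : A, 0 ≤ u → ∀ f : ℕ → A,
    (∀ ε : ℝ, 0 < ε → ∃ K : ℕ, ∀ m n : ℕ, K ≤ m → K ≤ n → |f m - f n| ≤ ε • u) →
    ∃ a : A, ∀ ε : ℝ, 0 < ε → ∃ K : ℕ, ∀ n : ℕ, K ≤ n → |f n - a| ≤ ε • u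

variable (A) in
/-- The weak factorization property: every element is dominated by a product. -/
def WeakFactorization [Mul A] : Prop := ∀ a : A, ∃ b c : A, a ≤ b * c


section DAlgebra

variable {A : Type*} [Lattice A] [AddCommGroup A] [Module ℝ A] [Mul A]

lemma IsLAlgebra.isOrderedAddMonoid (hA : IsLAlgebra A) : IsOrderedAddMonoid A where
  add_le_add_left a b hab c := by
    simpa only [add_comm] using hA.add_le_add_left a b hab c

lemma IsLAlgebra.mul_sub (hA : IsLAlgebra A) (a b c : A) : a * (b - c) = a * b - a * c := by
  rw [eq_sub_iff_add_eq, ← hA.left_distrib, sub_add_cancel]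

lemma IsLAlgebra.sub_mul (hA : IsLAlgebra A) (a b c : A) : (a - b) * c = a * c - b * c := by
  rw [eq_sub_iff_add_eq, ← hA.right_distrib, sub_add_cancel]

lemma IsLAlgebra.mul_nsmul (hA : IsLAlgebra A) (n : ℕ) (a b : A) : a * (n • b) = n • (a * b) := by
  rw [← Nat.cast_smul_eq_nsmul ℝ n b, ← Nat.cast_smul_eq_nsmul ℝ n (a * b), hA.mul_smul]

lemma IsLAlgebra.mul_le_mul_left_of_nonneg (hA : IsLAlgebra A) {a b c : A} (hbc : b ≤ c)
    (ha : 0 ≤ a) : a * b ≤ a * c := by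
  have := hA.isOrderedAddMonoid
  rw [← sub_nonneg, ← hA.mul_sub]
  exact hA.mul_nonneg _ _ ha (sub_nonneg.2 hbc)

lemma IsLAlgebra.mul_le_mul_right_of_nonneg (hA : IsLAlgebra A) {a b c : A} (hbc : b ≤ c)
    (ha : 0 ≤ a) : b * a ≤ c * a := by
  have := hA.isOrderedAddMonoid
  rw [← sub_nonneg, ← hA.sub_mul]
  exact hA.mul_nonneg _ _ (sub_nonneg.2 hbc) ha

/-- The multiplicative unit of a d-algebra is positive. -/
lemma IsDAlgebra.unit_nonneg (hA : IsDAlgebra A) {e : A} (he : IsMulUnit e) : 0 ≤ e := by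
  have := hA.isOrderedAddMonoid
  have key : ∀ a : A, 0 ≤ a → a * e⁻ = 0 := by
    intro a ha
    have hd := (hA.d_prop _ _ a (posPart_inf_negPart_eq_zero e) ha).2
    have hsub : a = a * e⁺ - a * e⁻ := by
      rw [← hA.mul_sub, posPart_sub_negPart, (he a).1]
    have hle : a * e⁻ ≤ a * e⁺ := by
      rw [← sub_nonneg, ← hsub]
      exact ha
    rwa [inf_eq_right.2 hle] at hd
  have h : e⁻ = 0 := by
    calc e⁻ = (e⁺ - e⁻) * e⁻ := by rw [posPart_sub_negPart, (he _).2]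
      _ = 0 := by
        rw [hA.sub_mul, key _ (posPart_nonneg e), key _ (negPart_nonneg e), sub_zero]
  exact negPart_eq_zero.1 h

/-- A d-algebra with a multiplicative unit is an f-algebra. -/
lemma IsDAlgebra.isFAlgebra (hA : IsDAlgebra A) {e : A} (he : IsMulUnit e) : IsFAlgebra A where
  toIsLAlgebra := hA.toIsLAlgebra
  f_prop a b c hab hc := by
    have ha : 0 ≤ a := hab ▸ inf_le_left
    have hb : 0 ≤ b := hab ▸ inf_le_right
    obtain ⟨h₁, h₂⟩ := hA.d_prop a b (c ⊔ e) hab (le_sup_of_le_left hc)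
    have hbl : b ≤ b * (c ⊔ e) := by
      simpa only [(he b).1] using hA.mul_le_mul_left_of_nonneg (le_sup_right : e ≤ c ⊔ e) hb
    have hbr : b ≤ (c ⊔ e) * b := by
      simpa only [(he b).2] using hA.mul_le_mul_right_of_nonneg (le_sup_right : e ≤ c ⊔ e) hb
    constructor
    · apply le_antisymm
      · rw [← h₁]
        exact inf_le_inf (hA.mul_le_mul_left_of_nonneg le_sup_left ha) hbl
      · exact le_inf (hA.mul_nonneg _ _ ha hc) hb
    · apply le_antisymm
      · rw [← h₂]
        exact inf_le_inf (hA.mul_le_mul_right_of_nonneg le_sup_left ha) hbr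
      · exact le_inf (hA.mul_nonneg _ _ hc ha) hb

lemma IsFAlgebra.mul_eq_zero_of_inf_eq_zero (hA : IsFAlgebra A) {a b : A} (hab : a ⊓ b = 0) :
    a * b = 0 := by
  have ha : 0 ≤ a := hab ▸ inf_le_left
  have hb : 0 ≤ b := hab ▸ inf_le_right
  have h := (hA.f_prop a b b hab hb).1
  rw [inf_comm] at h
  simpa only [inf_idem] using (hA.f_prop b (a * b) a h ha).2

/-- Truncations by multiples of a positive unit converge relatively uniformly:
`(x - n e)⁺ ≤ x² / n` for `x ≥ 0`. -/
lemma IsFAlgebra.nsmul_posPart_sub_le (hA : IsFAlgebra A) {e x : A} (he : IsMulUnit e)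
    (he₀ : 0 ≤ e) (hx : 0 ≤ x) (n : ℕ) : n • (x - n • e)⁺ ≤ x * x := by
  have := hA.isOrderedAddMonoid
  set y := x - n • e with hy
  have hyx : y⁺ ≤ x := sup_le (sub_le_self _ (nsmul_nonneg he₀ n)) hx
  have hpos : 0 ≤ y⁺ * y := by
    have : y⁺ * y = y⁺ * y⁺ := by
      calc y⁺ * y = y⁺ * (y⁺ - y⁻) := by rw [posPart_sub_negPart]
        _ = y⁺ * y⁺ := by
          rw [hA.mul_sub, hA.mul_eq_zero_of_inf_eq_zero (posPart_inf_negPart_eq_zero y), sub_zero]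
    rw [this]
    exact hA.mul_nonneg _ _ (posPart_nonneg y) (posPart_nonneg y)
  have hle : n • y⁺ ≤ y⁺ * x := by
    rw [hy, hA.mul_sub, hA.mul_nsmul, (he _).1, ← hy] at hpos
    exact sub_nonneg.1 hpos
  exact hle.trans (hA.mul_le_mul_right_of_nonneg hyx hx)

/-- In an f-algebra with a positive unit, any majorant of the unit is an order unit. -/
lemma IsFAlgebra.exists_abs_le_smul_of_isMajorant (hA : IsFAlgebra A) {e z : A}
    (he : IsMulUnit e) (he₀ : 0 ≤ e) (hz : IsMajorant z e) (x : A) :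
    ∃ c : ℝ, 0 < c ∧ |x| ≤ c • z := by
  have := hA.isOrderedAddMonoid
  obtain ⟨c, hc, h⟩ := hz.2 x
  refine ⟨c, hc, ?_⟩
  rw [← sub_nonpos, ← posPart_eq_zero]
  refine hA.archimedean _ (|x| * |x|) (posPart_nonneg _) fun n => ?_
  refine le_trans (nsmul_le_nsmul_right ?_ n)
    (hA.nsmul_posPart_sub_le he he₀ (abs_nonneg x) n)
  refine sup_le ?_ (posPart_nonneg _)
  have hn := h n
  rw [abs_of_nonneg he₀] at hn
  calc |x| - c • z ≤ |x| - |x| ⊓ n • e := sub_le_sub_left hn _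
    _ = (|x| - n • e)⁺ := by rw [inf_eq_sub_posPart_sub, sub_sub_cancel]

end DAlgebra

/-- In a d-algebra with a finite multiplicative unit `e`, every element is
finite and totally finite, i.e. `Φ₁(𝒜) = Φ₂(𝒜) = 𝒜`. -/
theorem stmt3 {A : Type*} [Lattice A] [AddCommGroup A] [Module ℝ A] [Mul A]
    (hA : IsDAlgebra A) (e : A) (hunit : IsMulUnit e) (hef : IsFiniteElt e) :
    ∀ a : A, IsFiniteElt a ∧ IsTotallyFiniteElt a := by
  have he₀ := hA.unit_nonneg hunit
  obtain ⟨z, hz⟩ := hef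
  have hmaj : ∀ a : A, IsMajorant z a := fun a => ⟨hz.1, fun x => by
    obtain ⟨c, hc, h⟩ := (hA.isFAlgebra hunit).exists_abs_le_smul_of_isMajorant hunit he₀ hz x
    exact ⟨c, hc, fun n => inf_le_left.trans h⟩⟩
  exact fun a => ⟨⟨z, hmaj a⟩, z, hmaj a, z, hmaj z⟩

end FiniteElementsPaper
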